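/- arXiv:0909.4372 — 4 statements merged into one kernel-verified Lean document; each statement's English description precedes it below -/
import Mathlib

section
/- Let 𝒳 be an O-family in ℝ^N. If 𝒳 is quasi-controllable, then qcm_s(𝒳) > 0 for every s ∈ 𝒮 (i.e., for every natural number s with s + 1 ≥ N). -/
open Set Filter Metric Pointwise

noncomputable section

variable {V : Type*} [NormedAddCommGroup V] [NormedSpace ℝ V]

/-- `famSet X u t s` is the set `𝒳(u, t, s) = {x(t) : x ∈ 𝒳, x(s) = u}`. -/
def famSet (X : Set (ℕ → V)) (u : V) (t s : ℕ) : Set V :=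
  {y | ∃ x ∈ X, x s = u ∧ x t = y}

/-- `𝒳` is an O-family: nonempty, satisfies the sewing condition, homogeneous,
time invariant, concave, locally bounded and continuous. -/
structure IsOFamily (X : Set (ℕ → V)) : Prop where
  nonempty : X.Nonempty
  sewing : ∀ ⦃t₁ t₂ t₃ : ℕ⦄, t₁ ≤ t₂ → t₂ ≤ t₃ → ∀ x ∈ X, ∀ y ∈ X, x t₂ = y t₂ →
    ∃ z ∈ X, (∀ t, t₁ ≤ t → t ≤ t₂ → z t = x t) ∧ (∀ t, t₂ ≤ t → t ≤ t₃ → z t = y t)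
  homog : ∀ (l : ℝ) (u : V) (t : ℕ), famSet X (l • u) t 0 = l • famSet X u t 0
  timeInv : ∀ (u : V) ⦃s t : ℕ⦄, s ≤ t → famSet X u t s = famSet X u (t - s) 0
  concave : ∀ ⦃l : ℝ⦄, 0 ≤ l → l ≤ 1 → ∀ (u v : V) (t : ℕ),
    famSet X (l • u + (1 - l) • v) t 0 ⊆ l • famSet X u t 0 + (1 - l) • famSet X v t 0
  locBdd : ∀ t : ℕ, ∃ ρ : ℝ, ∀ u : V, ‖u‖ = 1 → ∀ y ∈ famSet X u t 0, ‖y‖ ≤ ρ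
  contin : ∀ (u : ℕ → V) (u₀ : V), Tendsto u atTop (nhds u₀) → ∀ t : ℕ,
    Tendsto (fun n => hausdorffDist (famSet X (u n) t 0) (famSet X u₀ t 0)) atTop (nhds 0)

/-- Quasi-controllability: no nonzero proper linear subspace is invariant for `𝒳`. -/
def QuasiControllable (X : Set (ℕ → V)) : Prop :=
  ¬ ∃ E : Submodule ℝ V, E ≠ ⊥ ∧ E ≠ ⊤ ∧ ∀ x ∈ E, ∀ t : ℕ, famSet X x t 0 ⊆ (E : Set V)

/-- The absolutely convex hull `absco W = co (W ∪ (−W))`. -/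
def absco (W : Set V) : Set V := convexHull ℝ (W ∪ -W)

/-- The `s`-measure of quasi-controllability:
`qcm_s(𝒳) = inf_{‖x‖=1} sup {ρ ≥ 0 : ball of radius ρ ⊆ absco (⋃_{t ≤ s} 𝒳(x,t,0))}`. -/
def qcms (X : Set (ℕ → V)) (s : ℕ) : ℝ :=
  ⨅ x : {x : V // ‖x‖ = 1},
    sSup {ρ : ℝ | 0 ≤ ρ ∧ closedBall (0 : V) ρ ⊆ absco (⋃ t ≤ s, famSet X (x : V) t 0)}

/-- The quasi-controllability measure `qcm 𝒳 = sup_{s ∈ 𝒮} qcm_s 𝒳`,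
with `𝒮 = {s : dim V ≤ s + 1}`. -/
def qcm (X : Set (ℕ → V)) : ℝ :=
  ⨆ s : {s : ℕ // Module.finrank ℝ V ≤ s + 1}, qcms X (s : ℕ)

/-- Lyapunov stability of an O-family. -/
def LyapunovStable (X : Set (ℕ → V)) : Prop :=
  ∃ μ > (0 : ℝ), ∀ (x : V) (t : ℕ), ∀ u ∈ famSet X x t 0, ‖u‖ ≤ μ * ‖x‖

/-- The overshooting measure: the greatest lower bound of the Lyapunov stability constants. -/
def ovm (X : Set (ℕ → V)) : ℝ :=
  sInf {μ : ℝ | 0 < μ ∧ ∀ (x : V) (t : ℕ), ∀ u ∈ famSet X x t 0, ‖u‖ ≤ μ * ‖x‖}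

/-- Convergence of a sequence of O-families to an O-family. -/
def OFamTendsto (Xn : ℕ → Set (ℕ → V)) (X : Set (ℕ → V)) : Prop :=
  ∀ (x : V) (s : ℕ), Tendsto (fun n => ⨆ t : Fin (s + 1),
    hausdorffDist (closure (famSet (Xn n) x (t : ℕ) 0)) (closure (famSet X x (t : ℕ) 0)))
    atTop (nhds 0)

/-- Absolute exponential instability with exponent `ε`. -/
def AbsExpUnstable (X : Set (ℕ → V)) (ε : ℝ) : Prop :=
  ∃ γ > (0 : ℝ), ∀ u : V, ‖u‖ = 1 → ∃ x ∈ X, x 0 = u ∧ ∀ t : ℕ, γ * Real.exp (ε * t) ≤ ‖x t‖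

/-- Exponential stability of an O-family. -/
def ExpStable (X : Set (ℕ → V)) : Prop :=
  ∃ ε > (0 : ℝ), ∃ μ > (0 : ℝ), ∀ (x : V) (t : ℕ), ∀ u ∈ famSet X x t 0,
    ‖u‖ ≤ μ * Real.exp (-ε * t) * ‖x‖

end

section helpers

variable {V : Type*} [NormedAddCommGroup V] [NormedSpace ℝ V]

theorem fam_zero {X : Set (ℕ → V)} (hO : IsOFamily X) (t : ℕ) : famSet X (0 : V) t 0 = {0} := by
  obtain ⟨x, hx⟩ := hO.nonempty
  have hne : (famSet X (x 0) t 0).Nonempty := ⟨x t, x, hx, rfl, rfl⟩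
  have h := hO.homog 0 (x 0) t
  rw [zero_smul, Set.zero_smul_set hne] at h
  exact h

theorem fam_nonempty {X : Set (ℕ → V)} (hO : IsOFamily X) (u : V) (t : ℕ) :
    (famSet X u t 0).Nonempty := by
  by_contra h
  rw [Set.not_nonempty_iff_eq_empty] at h
  have h1 := hO.homog 0 u t
  rw [zero_smul, h, fam_zero hO, Set.smul_set_empty] at h1
  exact Set.singleton_ne_empty _ h1

theorem fam_self {X : Set (ℕ → V)} (hO : IsOFamily X) (u : V) : u ∈ famSet X u 0 0 := by
  obtain ⟨y, x, hx, h0, h1⟩ := fam_nonempty hO u 0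
  exact ⟨x, hx, h0, h0⟩

theorem fam_bdd {X : Set (ℕ → V)} (hO : IsOFamily X) (u : V) (t : ℕ) :
    Bornology.IsBounded (famSet X u t 0) := by
  obtain ⟨ρ, hρ⟩ := hO.locBdd t
  by_cases hu : u = 0
  · subst hu
    rw [fam_zero hO]
    exact Bornology.isBounded_singleton
  · have h : u = ‖u‖ • (‖u‖⁻¹ • u) := by
      rw [smul_smul, mul_inv_cancel₀ (norm_ne_zero_iff.2 hu), one_smul]
    rw [h, hO.homog]
    refine Bornology.IsBounded.smul₀ ?_ _
    rw [isBounded_iff_forall_norm_le]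
    exact ⟨ρ, fun y hy => hρ _ (by rw [norm_smul, norm_inv, norm_norm, inv_mul_cancel₀ (norm_ne_zero_iff.2 hu)]) y hy⟩

theorem fam_comp {X : Set (ℕ → V)} (hO : IsOFamily X) {u y w : V} {τ : ℕ}
    (hy : y ∈ famSet X u τ 0) (hw : w ∈ famSet X y 1 0) : w ∈ famSet X u (τ + 1) 0 := by
  have h := hO.timeInv y (Nat.le_succ τ)
  rw [Nat.succ_eq_add_one, Nat.add_sub_cancel_left] at h
  rw [← h] at hw
  obtain ⟨a, ha, ha0, haτ⟩ := hy
  obtain ⟨b, hb, hbτ, hb1⟩ := hw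
  obtain ⟨z, hz, h1, h2⟩ := hO.sewing (Nat.zero_le τ) (Nat.le_succ τ) a ha b hb (by rw [haτ, hbτ])
  exact ⟨z, hz, by rw [h1 0 le_rfl (Nat.zero_le _), ha0], by rw [h2 _ (Nat.le_succ _) le_rfl, hb1]⟩

theorem fam_add {X : Set (ℕ → V)} (hO : IsOFamily X) {u v w : V} {t : ℕ}
    (hw : w ∈ famSet X (u + v) t 0) :
    ∃ a ∈ famSet X u t 0, ∃ b ∈ famSet X v t 0, a + b = w := by
  have h := hO.concave (l := 1 / 2) (by norm_num) (by norm_num) ((2 : ℝ) • u) ((2 : ℝ) • v) t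
  rw [hO.homog 2 u, hO.homog 2 v, smul_smul, smul_smul, smul_smul, smul_smul] at h
  norm_num at h
  exact Set.mem_add.1 (h hw)

/-- The span of the reachable points in time at most `s`. -/
def reachSpan (X : Set (ℕ → V)) (x : V) (s : ℕ) : Submodule ℝ V :=
  Submodule.span ℝ (⋃ t ≤ s, famSet X x t 0)

theorem reachSpan_mono (X : Set (ℕ → V)) (x : V) {s t : ℕ} (h : s ≤ t) :
    reachSpan X x s ≤ reachSpan X x t :=
  Submodule.span_mono (Set.biUnion_subset_biUnion_left fun _ hi => le_trans hi h)

theorem reachSpan_step {X : Set (ℕ → V)} (hO : IsOFamily X) (x : V) (s : ℕ) (y : V)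
    (hy : y ∈ reachSpan X x s) : famSet X y 1 0 ⊆ reachSpan X x (s + 1) := by
  unfold reachSpan at hy
  induction hy using Submodule.span_induction with
  | mem y hy =>
    intro w hw
    simp only [Set.mem_iUnion] at hy
    obtain ⟨t, ht, hy⟩ := hy
    refine Submodule.subset_span ?_
    simp only [Set.mem_iUnion]
    exact ⟨t + 1, by omega, fam_comp hO hy hw⟩
  | zero =>
    rw [fam_zero hO]
    simp
  | add u v _ _ hu hv =>
    intro w hw
    obtain ⟨a, ha, b, hb, rfl⟩ := fam_add hO hw
    exact Submodule.add_mem _ (hu ha) (hv hb)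
  | smul c u _ hu =>
    rw [hO.homog]
    rintro _ ⟨a, ha, rfl⟩
    exact Submodule.smul_mem _ _ (hu ha)

theorem inv_of_step {X : Set (ℕ → V)} (hO : IsOFamily X) (E : Submodule ℝ V)
    (h : ∀ y ∈ E, famSet X y 1 0 ⊆ (E : Set V)) :
    ∀ x ∈ E, ∀ t : ℕ, famSet X x t 0 ⊆ (E : Set V) := by
  rintro x hx t y ⟨z, hz, rfl, rfl⟩
  induction t with
  | zero => exact hx
  | succ t ih =>
    refine h _ ih ?_
    have h := hO.timeInv (z t) (Nat.le_succ t)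
    rw [Nat.succ_eq_add_one, Nat.add_sub_cancel_left] at h
    rw [← h]
    exact ⟨z, hz, rfl, rfl⟩

theorem reachSpan_top [FiniteDimensional ℝ V] {X : Set (ℕ → V)} (hO : IsOFamily X)
    (hqc : QuasiControllable X) {x : V} (hx : x ≠ 0) (s : ℕ)
    (hs : Module.finrank ℝ V ≤ s + 1) : reachSpan X x s = ⊤ := by
  have hmem : ∀ s, x ∈ reachSpan X x s := fun s => by
    refine Submodule.subset_span ?_
    simp only [Set.mem_iUnion]
    exact ⟨0, Nat.zero_le _, fam_self hO x⟩
  have key : ∀ s, reachSpan X x s = ⊤ ∨ s + 1 ≤ Module.finrank ℝ (reachSpan X x s) := by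
    intro s
    induction s with
    | zero =>
      right
      have : Nontrivial (reachSpan X x 0) :=
        ⟨⟨⟨x, hmem 0⟩, 0, fun h => hx (congrArg Subtype.val h)⟩⟩
      have := Module.finrank_pos (R := ℝ) (M := reachSpan X x 0)
      omega
    | succ s ih =>
      have hle := reachSpan_mono X x (Nat.le_succ s)
      rcases ih with ih | ih
      · left
        rw [ih] at hle
        exact top_le_iff.1 hle
      · rcases hle.lt_or_eq with hlt | heq
        · right
          have := Submodule.finrank_lt_finrank_of_lt hlt
          simp only [Nat.succ_eq_add_one] at this
          omega
        · left
          by_contra hne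
          refine hqc ⟨reachSpan X x s, ?_, ?_, ?_⟩
          · intro hb
            have := hmem s
            rw [hb] at this
            exact hx (by simpa using this)
          · rw [heq]; exact hne
          · refine inv_of_step hO _ fun y hy => ?_
            have := reachSpan_step hO x s y hy
            rw [heq]
            exact this
  rcases key s with h | h
  · exact h
  · exact Submodule.eq_top_of_finrank_eq (le_antisymm (Submodule.finrank_le _) (by omega))

end helpers

section euclid

variable {V : Type*} [NormedAddCommGroup V] [InnerProductSpace ℝ V] [FiniteDimensional ℝ V]

theorem unif_bound {X : Set (ℕ → V)} (hO : IsOFamily X)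
    (hqc : QuasiControllable X) (s : ℕ)
    (hs : Module.finrank ℝ V ≤ s + 1) :
    ∃ r > (0 : ℝ), ∀ x φ : V, ‖x‖ = 1 → ‖φ‖ = 1 →
      ∃ w ∈ ⋃ t ≤ s, famSet X x t 0, r < |inner ℝ φ w| := by
  by_contra! hcon
  choose x φ hx hφ hb using fun n : ℕ => hcon (1 / ((n : ℝ) + 1)) Nat.one_div_pos_of_nat
  have hcpt : IsCompact (sphere (0 : V) 1 ×ˢ sphere (0 : V) 1) :=
    (isCompact_sphere _ _).prod (isCompact_sphere _ _)
  obtain ⟨⟨x0, φ0⟩, ⟨hx0, hφ0⟩, k, hk, hlim⟩ := hcpt.tendsto_subseq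
    (x := fun n => (x n, φ n)) (fun n => by simp [hx, hφ])
  have hlx : Tendsto (fun n => x (k n)) atTop (nhds x0) :=
    (continuous_fst.tendsto _).comp hlim
  have hlφ : Tendsto (fun n => φ (k n)) atTop (nhds φ0) :=
    (continuous_snd.tendsto _).comp hlim
  have hx0' : ‖x0‖ = 1 := by simpa using hx0
  have hφ0' : ‖φ0‖ = 1 := by simpa using hφ0
  have hzero : ∀ w ∈ ⋃ t ≤ s, famSet X x0 t 0, inner ℝ φ0 w = 0 := by
    intro w hw
    simp only [Set.mem_iUnion] at hw
    obtain ⟨t, ht, hw⟩ := hw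
    have hH := hO.contin _ _ hlx t
    have hex : ∀ n, ∃ w' ∈ famSet X (x (k n)) t 0, dist w' w <
        hausdorffDist (famSet X (x (k n)) t 0) (famSet X x0 t 0) + 1 / ((n : ℝ) + 1) := by
      intro n
      refine exists_dist_lt_of_hausdorffDist_lt' hw
        (lt_add_of_pos_right _ Nat.one_div_pos_of_nat)
        (hausdorffEDist_ne_top_of_nonempty_of_bounded (fam_nonempty hO _ _)
          (fam_nonempty hO _ _) (fam_bdd hO _ _) (fam_bdd hO _ _))
    choose w' hw' hd using hex
    have hlw : Tendsto w' atTop (nhds w) := by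
      rw [tendsto_iff_dist_tendsto_zero]
      refine squeeze_zero (fun _ => dist_nonneg) (fun n => (hd n).le) ?_
      simpa using hH.add tendsto_one_div_add_atTop_nhds_zero_nat
    have h1 : Tendsto (fun n => |inner ℝ (φ (k n)) (w' n)|) atTop (nhds |inner ℝ φ0 w|) :=
      (hlφ.inner hlw).abs
    have h2 : Tendsto (fun n => |inner ℝ (φ (k n)) (w' n)|) atTop (nhds 0) := by
      refine squeeze_zero (fun _ => abs_nonneg _) (fun n => hb (k n) (w' n) ?_)
        ((tendsto_one_div_add_atTop_nhds_zero_nat (𝕜 := ℝ)).comp hk.tendsto_atTop)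
      simp only [Set.mem_iUnion]
      exact ⟨t, ht, hw' n⟩
    exact abs_eq_zero.1 (tendsto_nhds_unique h1 h2)
  have hx0ne : x0 ≠ 0 := by rintro rfl; simp at hx0'
  have htop := reachSpan_top hO hqc hx0ne s hs
  have hle : reachSpan X x0 s ≤ LinearMap.ker (innerSL ℝ φ0).toLinearMap :=
    Submodule.span_le.2 fun w hw => by
      simpa using hzero w hw
  have : φ0 ∈ reachSpan X x0 s := by rw [htop]; trivial
  have h3 : inner ℝ φ0 φ0 = (0 : ℝ) := by simpa using hle this
  rw [inner_self_eq_zero] at h3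
  rw [h3] at hφ0'
  simp at hφ0'

theorem ball_sub_absco {W : Set V} (hspan : Submodule.span ℝ W = ⊤) (hne : W.Nonempty) {r : ℝ}
    (h : ∀ φ : V, ‖φ‖ = 1 → ∃ w ∈ W, r < |inner ℝ φ w|) : ball (0 : V) r ⊆ absco W := by
  have hconv : Convex ℝ (absco W) := convex_convexHull ℝ _
  have hsub : W ∪ -W ⊆ absco W := subset_convexHull ℝ _
  have h0 : (0 : V) ∈ absco W := by
    obtain ⟨w, hw⟩ := hne
    have := hconv (hsub (Or.inl hw)) (hsub (Or.inr (by simpa using hw : -w ∈ -W)))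
      (a := 1 / 2) (b := 1 / 2) (by norm_num) (by norm_num) (by norm_num)
    simpa using this
  have hint : (interior (absco W)).Nonempty := by
    rw [hconv.interior_nonempty_iff_affineSpan_eq_top]
    have h0' : (0 : V) ∈ affineSpan ℝ (absco W) := subset_affineSpan ℝ _ h0
    rw [AffineSubspace.affineSpan_eq_top_iff_vectorSpan_eq_top_of_nonempty ℝ V V ⟨0, h0⟩]
    rw [eq_top_iff, ← hspan]
    refine Submodule.span_le.2 fun w hw => ?_
    simpa using vsub_mem_vectorSpan ℝ (hsub (Or.inl hw)) h0
  have hcl : ball (0 : V) r ⊆ closure (absco W) := by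
    intro y hy
    by_contra hyn
    obtain ⟨f, u, hfu, huf⟩ := geometric_hahn_banach_closed_point hconv.closure isClosed_closure hyn
    obtain ⟨v, rfl⟩ := (InnerProductSpace.toDual ℝ V).surjective f
    simp only [InnerProductSpace.toDual_apply_apply] at hfu huf
    have hu : 0 < u := by simpa using hfu 0 (subset_closure h0)
    have hv : v ≠ 0 := by
      rintro rfl
      simp at huf
      linarith
    have hvp : 0 < ‖v‖ := norm_pos_iff.2 hv
    obtain ⟨w, hw, hr⟩ := h (‖v‖⁻¹ • v) (norm_smul_inv_norm hv)
    rw [real_inner_smul_left, abs_mul, abs_of_pos (inv_pos.2 hvp), inv_mul_eq_div,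
      lt_div_iff₀ hvp] at hr
    have h1 := hfu w (subset_closure (hsub (Or.inl hw)))
    have h2 := hfu (-w) (subset_closure (hsub (Or.inr (by simpa using hw : -w ∈ -W))))
    rw [inner_neg_right] at h2
    have h3 : |inner ℝ v w| < u := abs_lt.2 ⟨by linarith, h1⟩
    have h4 := real_inner_le_norm v y
    have hy' : ‖y‖ < r := by simpa using hy
    nlinarith
  have := interior_maximal hcl isOpen_ball
  rw [hconv.interior_closure_eq_interior_of_nonempty_interior hint] at this
  exact this.trans interior_subset

end euclid

/-- If a quasi-controllable O-family `𝒳` in `ℝ^N` is quasi-controllable, then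
`qcm_s(𝒳) > 0` for every `s ∈ 𝒮 = {s : s + 1 ≥ N}`. -/
theorem qcms_pos_of_quasiControllable {N : ℕ} (hN : 1 ≤ N)
    (X : Set (ℕ → EuclideanSpace ℝ (Fin N))) (hO : IsOFamily X) (hqc : QuasiControllable X) :
    ∀ s : ℕ, N ≤ s + 1 → 0 < qcms X s := by
  
  intro s hs
  have hfr : Module.finrank ℝ (EuclideanSpace ℝ (Fin N)) ≤ s + 1 := by simpa using hs
  obtain ⟨r, hr, hb⟩ := unif_bound hO hqc s hfr
  have : Nonempty {x : EuclideanSpace ℝ (Fin N) // ‖x‖ = 1} :=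
    ⟨⟨EuclideanSpace.single ⟨0, hN⟩ 1, by simp⟩⟩
  refine lt_of_lt_of_le (half_pos hr) (le_ciInf ?_)
  rintro ⟨x, hx⟩
  have hxne : x ≠ 0 := by rintro rfl; simp at hx
  refine le_csSup ?_ ⟨(half_pos hr).le, ?_⟩
  · have hbd : Bornology.IsBounded (absco (⋃ t ≤ s, famSet X x t 0)) := by
      have h1 : Bornology.IsBounded (⋃ t ≤ s, famSet X x t 0) :=
        (Bornology.isBounded_biUnion (Set.finite_Iic s)).2 fun t _ => fam_bdd hO x t
      exact isBounded_convexHull.2 (h1.union h1.neg)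
    obtain ⟨R, hR⟩ := isBounded_iff_forall_norm_le.1 hbd
    refine ⟨R, ?_⟩
    rintro ρ ⟨hρ, hsub⟩
    have := hR (ρ • x) (hsub (by simp [norm_smul, hx, abs_of_nonneg hρ]))
    simpa [norm_smul, hx, abs_of_nonneg hρ] using this
  · refine (closedBall_subset_ball (half_lt_self hr)).trans
      (ball_sub_absco (reachSpan_top hO hqc hxne s hfr) ?_ fun φ hφ => hb x φ hx hφ)
    refine ⟨x, ?_⟩
    simp only [Set.mem_iUnion]
    exact ⟨0, Nat.zero_le _, fam_self hO x⟩
end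

section
/- For any two O-families 𝒳 and 𝒳* in ℝ^N and any s ∈ 𝒮, the s-measures of quasi-controllability satisfy |qcm_s(𝒳*) − qcm_s(𝒳)| ≤ ρ_s(𝒳, 𝒳*), where ρ_s(𝒳, 𝒳*) = sup over t ≤ s and ‖x‖ ≤ 1 of the Hausdorff distance H(cl 𝒳(x,t,0), cl 𝒳*(x,t,0)). -/
open Set Filter Metric Pointwise

noncomputable section

/-- `ρ_s(𝒳, 𝒳*) = sup_{t ≤ s, ‖x‖ ≤ 1} H(cl 𝒳(x,t,0), cl 𝒳*(x,t,0))`. -/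
def rhoDist {N : ℕ} (X Xs : Set (ℕ → EuclideanSpace ℝ (Fin N))) (s : ℕ) : ℝ :=
  sSup {d : ℝ | ∃ t ≤ s, ∃ x : EuclideanSpace ℝ (Fin N), ‖x‖ ≤ 1 ∧
    d = Metric.hausdorffDist (closure (famSet X x t 0)) (closure (famSet Xs x t 0))}

end

section helpers

theorem aux_interior_closure {V : Type*} [NormedAddCommGroup V] [NormedSpace ℝ V]
    [FiniteDimensional ℝ V] {A : Set V} (hA : Convex ℝ A) :
    interior (closure A) ⊆ A := by
  intro y hy
  have hne : (interior (closure A)).Nonempty := ⟨y, hy⟩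
  have h1 : affineSpan ℝ (closure A) = ⊤ :=
    (hA.closure.interior_nonempty_iff_affineSpan_eq_top).1 hne
  have h2 : affineSpan ℝ (closure A) ≤ affineSpan ℝ A := by
    rw [affineSpan_le]
    exact closure_minimal (subset_affineSpan ℝ A)
      (AffineSubspace.closed_of_finiteDimensional (affineSpan ℝ A))
  have h3 : affineSpan ℝ A = ⊤ := top_unique (h1 ▸ h2)
  have h4 := (hA.interior_nonempty_iff_affineSpan_eq_top).2 h3
  rw [hA.interior_closure_eq_interior_of_nonempty_interior h4] at hy
  exact interior_subset hy

/-- Rådström-type cancellation. -/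
theorem aux_cancel {V : Type*} [NormedAddCommGroup V] [InnerProductSpace ℝ V]
    [FiniteDimensional ℝ V] {A : Set V} (hA : Convex ℝ A) {ρ δ c : ℝ} (hδ : 0 ≤ δ)
    (hc : c < ρ - δ) (h : closedBall (0 : V) ρ ⊆ A + closedBall (0 : V) δ) :
    closedBall (0 : V) c ⊆ A := by
  have key : ball (0 : V) (ρ - δ) ⊆ closure A := by
    intro z hz
    rw [mem_ball_zero_iff] at hz
    by_contra hzA
    obtain ⟨f, u, hfa, hfz⟩ := geometric_hahn_banach_closed_point hA.closure isClosed_closure hzA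
    set v := (InnerProductSpace.toDual ℝ V).symm f with hv
    have hfv : ∀ w, f w = inner ℝ v w := fun w => by
      rw [hv, InnerProductSpace.toDual_symm_apply]
    have hpt : ∀ w : V, ‖w‖ ≤ ρ → f w ≤ u + ‖v‖ * δ := by
      intro w hw
      obtain ⟨a, ha, b, hb, hab⟩ := h (mem_closedBall_zero_iff.2 hw)
      simp only at hab
      rw [mem_closedBall_zero_iff] at hb
      have h1 := hfa a (subset_closure ha)
      have h2 : f b ≤ ‖v‖ * δ := by
        rw [hfv]
        exact (real_inner_le_norm v b).trans (mul_le_mul_of_nonneg_left hb (norm_nonneg _))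
      rw [← hab, map_add]
      linarith
    have hv0 : v ≠ 0 := by
      intro h0
      have h1 := hpt z (by linarith)
      rw [h0] at h1
      simp at h1
      linarith
    have hvp : 0 < ‖v‖ := norm_pos_iff.2 hv0
    have h1 := hpt (z + ((ρ - ‖z‖) / ‖v‖) • v) (by
      refine (norm_add_le _ _).trans ?_
      rw [norm_smul, Real.norm_of_nonneg (div_nonneg (by linarith) hvp.le),
        div_mul_cancel₀ _ hvp.ne']
      linarith)
    rw [map_add, map_smul, hfv v, real_inner_self_eq_norm_sq, smul_eq_mul] at h1
    have h2 : (ρ - ‖z‖) / ‖v‖ * ‖v‖ ^ 2 = (ρ - ‖z‖) * ‖v‖ := by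
      field_simp
    rw [h2] at h1
    nlinarith
  intro y hy
  apply aux_interior_closure hA
  refine interior_maximal key isOpen_ball ?_
  rw [mem_closedBall_zero_iff] at hy
  rw [mem_ball_zero_iff]
  linarith

theorem aux_zero {V : Type*} [NormedAddCommGroup V] [NormedSpace ℝ V] {X : Set (ℕ → V)}
    (hO : IsOFamily X) (t : ℕ) : famSet X 0 t 0 = {0} := by
  obtain ⟨x, hx⟩ := hO.nonempty
  have h := hO.homog 0 (x 0) t
  have hne : (famSet X (x 0) t 0).Nonempty := ⟨x t, x, hx, rfl, rfl⟩
  rw [zero_smul, Set.zero_smul_set hne] at h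
  exact h

theorem aux_ne {V : Type*} [NormedAddCommGroup V] [NormedSpace ℝ V] {X : Set (ℕ → V)}
    (hO : IsOFamily X) (u : V) (t : ℕ) : (famSet X u t 0).Nonempty := by
  have h := hO.homog 0 u t
  rw [zero_smul, aux_zero hO] at h
  by_contra hne
  rw [Set.not_nonempty_iff_eq_empty] at hne
  rw [hne, Set.smul_set_empty] at h
  exact Set.singleton_ne_empty _ h

theorem aux_bdd {V : Type*} [NormedAddCommGroup V] [NormedSpace ℝ V] {X : Set (ℕ → V)}
    (hO : IsOFamily X) (s : ℕ) : ∃ R : ℝ, 0 ≤ R ∧ ∀ t ≤ s, ∀ u : V, ‖u‖ ≤ 1 →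
      ∀ y ∈ famSet X u t 0, ‖y‖ ≤ R := by
  choose ρ hρ using hO.locBdd
  refine ⟨∑ t ∈ Finset.range (s + 1), |ρ t|, Finset.sum_nonneg fun _ _ => abs_nonneg _, ?_⟩
  intro t ht u hu y hy
  have hle : |ρ t| ≤ ∑ t ∈ Finset.range (s + 1), |ρ t| :=
    Finset.single_le_sum (f := fun t => |ρ t|) (fun _ _ => abs_nonneg _)
      (Finset.mem_range.2 (by omega))
  refine le_trans ?_ hle
  by_cases h0 : u = 0
  · rw [h0, aux_zero hO] at hy
    rw [Set.mem_singleton_iff.1 hy, norm_zero]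
    exact abs_nonneg _
  · have hup : 0 < ‖u‖ := norm_pos_iff.2 h0
    have h1 : u = ‖u‖ • (‖u‖⁻¹ • u) := by
      rw [smul_smul, mul_inv_cancel₀ hup.ne', one_smul]
    rw [h1, hO.homog] at hy
    obtain ⟨w, hw, rfl⟩ := hy
    have h2 := hρ t (‖u‖⁻¹ • u) (by
      rw [norm_smul, norm_inv, norm_norm, inv_mul_cancel₀ hup.ne']) w hw
    simp only [norm_smul, norm_norm]
    have := le_abs_self (ρ t)
    nlinarith [norm_nonneg w]

theorem aux_rho_comm {N : ℕ} (X Xs : Set (ℕ → EuclideanSpace ℝ (Fin N))) (s : ℕ) :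
    rhoDist X Xs s = rhoDist Xs X s := by
  unfold rhoDist
  simp only [hausdorffDist_comm (s := closure (famSet X _ _ 0))]

theorem aux_rho_nonneg {N : ℕ} (X Xs : Set (ℕ → EuclideanSpace ℝ (Fin N))) (s : ℕ) :
    0 ≤ rhoDist X Xs s := by
  apply Real.sSup_nonneg
  rintro d ⟨t, _, x, _, rfl⟩
  exact hausdorffDist_nonneg

theorem aux_rho_le {N : ℕ} {X Xs : Set (ℕ → EuclideanSpace ℝ (Fin N))}
    (hO : IsOFamily X) (hOs : IsOFamily Xs) {s t : ℕ} (ht : t ≤ s)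
    {x : EuclideanSpace ℝ (Fin N)} (hx : ‖x‖ ≤ 1) :
    hausdorffDist (famSet X x t 0) (famSet Xs x t 0) ≤ rhoDist X Xs s := by
  obtain ⟨R, hR, hRb⟩ := aux_bdd hO s
  obtain ⟨R', hR', hRb'⟩ := aux_bdd hOs s
  refine le_csSup ⟨R + R', ?_⟩ ⟨t, ht, x, hx, hausdorffDist_closure.symm⟩
  rintro d ⟨t, ht, x, hx, rfl⟩
  rw [hausdorffDist_closure]
  obtain ⟨a, ha⟩ := aux_ne hO x t
  obtain ⟨b, hb⟩ := aux_ne hOs x t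
  apply hausdorffDist_le_of_mem_dist (by linarith)
  · intro y hy
    refine ⟨b, hb, (dist_le_norm_add_norm _ _).trans ?_⟩
    linarith [hRb t ht x hx y hy, hRb' t ht x hx b hb]
  · intro y hy
    refine ⟨a, ha, (dist_le_norm_add_norm _ _).trans ?_⟩
    linarith [hRb t ht x hx a ha, hRb' t ht x hx y hy]

theorem aux_exists {N : ℕ} {X Xs : Set (ℕ → EuclideanSpace ℝ (Fin N))}
    (hO : IsOFamily X) (hOs : IsOFamily Xs) {s t : ℕ} (ht : t ≤ s)
    {x : EuclideanSpace ℝ (Fin N)} (hx : ‖x‖ ≤ 1) {δ : ℝ} (hδ : rhoDist X Xs s < δ)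
    {y : EuclideanSpace ℝ (Fin N)} (hy : y ∈ famSet X x t 0) :
    ∃ z ∈ famSet Xs x t 0, dist y z < δ := by
  obtain ⟨R, hR, hRb⟩ := aux_bdd hO s
  obtain ⟨R', hR', hRb'⟩ := aux_bdd hOs s
  refine exists_dist_lt_of_hausdorffDist_lt hy ((aux_rho_le hO hOs ht hx).trans_lt hδ) ?_
  refine hausdorffEDist_ne_top_of_nonempty_of_bounded (aux_ne hO x t) (aux_ne hOs x t) ?_ ?_
  · exact isBounded_closedBall.subset
      (fun y hy => mem_closedBall_zero_iff.2 (hRb t ht x hx y hy))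
  · exact isBounded_closedBall.subset
      (fun y hy => mem_closedBall_zero_iff.2 (hRb' t ht x hx y hy))

theorem aux_absco {N : ℕ} {X Xs : Set (ℕ → EuclideanSpace ℝ (Fin N))}
    (hO : IsOFamily X) (hOs : IsOFamily Xs) {s : ℕ}
    {x : EuclideanSpace ℝ (Fin N)} (hx : ‖x‖ ≤ 1) {δ : ℝ} (hδ : rhoDist X Xs s < δ) :
    absco (⋃ t ≤ s, famSet X x t 0) ⊆
      absco (⋃ t ≤ s, famSet Xs x t 0) + closedBall 0 δ := by
  refine convexHull_min ?_ ((convex_convexHull ℝ _).add (convex_closedBall _ _))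
  have key : ∀ y ∈ ⋃ t ≤ s, famSet X x t 0, ∃ z ∈ ⋃ t ≤ s, famSet Xs x t 0, ‖y - z‖ ≤ δ := by
    intro y hy
    simp only [Set.mem_iUnion] at hy
    obtain ⟨t, ht, hy⟩ := hy
    obtain ⟨z, hz, hd⟩ := aux_exists hO hOs ht hx hδ hy
    refine ⟨z, ?_, by rw [← dist_eq_norm]; exact hd.le⟩
    simp only [Set.mem_iUnion]
    exact ⟨t, ht, hz⟩
  rintro y (hy | hy)
  · obtain ⟨z, hz, hd⟩ := key y hy
    exact ⟨z, subset_convexHull ℝ _ (Or.inl hz), y - z, mem_closedBall_zero_iff.2 hd,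
      add_sub_cancel _ _⟩
  · obtain ⟨z, hz, hd⟩ := key (-y) hy
    refine ⟨-z, subset_convexHull ℝ _ (Or.inr (by simpa using hz)), y - -z,
      mem_closedBall_zero_iff.2 ?_, add_sub_cancel _ _⟩
    have he : -y - z = -(y - -z) := by abel
    rwa [he, norm_neg] at hd

theorem aux_bddAbove {N : ℕ} {X : Set (ℕ → EuclideanSpace ℝ (Fin N))}
    (hO : IsOFamily X) (s : ℕ) {x : EuclideanSpace ℝ (Fin N)} (hx : ‖x‖ = 1) :
    BddAbove {ρ : ℝ | 0 ≤ ρ ∧ closedBall (0 : EuclideanSpace ℝ (Fin N)) ρ ⊆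
      absco (⋃ t ≤ s, famSet X x t 0)} := by
  obtain ⟨R, hR, hRb⟩ := aux_bdd hO s
  have hsub : absco (⋃ t ≤ s, famSet X x t 0) ⊆ closedBall 0 R := by
    refine convexHull_min ?_ (convex_closedBall _ _)
    have key : ∀ y ∈ ⋃ t ≤ s, famSet X x t 0, ‖y‖ ≤ R := by
      intro y hy
      simp only [Set.mem_iUnion] at hy
      obtain ⟨t, ht, hy⟩ := hy
      exact hRb t ht x hx.le y hy
    rintro y (hy | hy)
    · exact mem_closedBall_zero_iff.2 (key y hy)
    · rw [mem_closedBall_zero_iff, ← norm_neg]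
      exact key (-y) hy
  refine ⟨R, ?_⟩
  rintro ρ ⟨hρ, hb⟩
  have h1 : ρ • x ∈ closedBall (0 : EuclideanSpace ℝ (Fin N)) R := by
    apply hsub
    apply hb
    rw [mem_closedBall_zero_iff, norm_smul, hx, Real.norm_of_nonneg hρ, mul_one]
  rwa [mem_closedBall_zero_iff, norm_smul, hx, Real.norm_of_nonneg hρ, mul_one] at h1

theorem aux_sSup_le {N : ℕ} {X Xs : Set (ℕ → EuclideanSpace ℝ (Fin N))}
    (hO : IsOFamily X) (hOs : IsOFamily Xs) (s : ℕ)
    {x : EuclideanSpace ℝ (Fin N)} (hx : ‖x‖ = 1) :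
    sSup {ρ : ℝ | 0 ≤ ρ ∧ closedBall (0 : EuclideanSpace ℝ (Fin N)) ρ ⊆
        absco (⋃ t ≤ s, famSet X x t 0)} ≤
      sSup {ρ : ℝ | 0 ≤ ρ ∧ closedBall (0 : EuclideanSpace ℝ (Fin N)) ρ ⊆
        absco (⋃ t ≤ s, famSet Xs x t 0)} + rhoDist X Xs s := by
  have hr := aux_rho_nonneg X Xs s
  have h0 : 0 ≤ sSup {ρ : ℝ | 0 ≤ ρ ∧ closedBall (0 : EuclideanSpace ℝ (Fin N)) ρ ⊆
        absco (⋃ t ≤ s, famSet Xs x t 0)} := Real.sSup_nonneg fun ρ hρ => hρ.1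
  refine Real.sSup_le ?_ (by linarith)
  rintro ρ ⟨hρ, hb⟩
  refine le_of_forall_pos_le_add fun ε hε => ?_
  by_cases hlt : ρ ≤ rhoDist X Xs s + ε
  · linarith
  · have h1 := aux_cancel (A := absco (⋃ t ≤ s, famSet Xs x t 0)) (convex_convexHull ℝ _)
      (δ := rhoDist X Xs s + ε / 2) (c := ρ - rhoDist X Xs s - ε) (by linarith) (by linarith)
      (hb.trans (aux_absco hO hOs hx.le (by linarith)))
    have h2 := le_csSup (aux_bddAbove hOs s hx) ⟨by linarith, h1⟩
    linarith

theorem aux_qcms_le {N : ℕ} (hN : 1 ≤ N) {X Xs : Set (ℕ → EuclideanSpace ℝ (Fin N))}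
    (hO : IsOFamily X) (hOs : IsOFamily Xs) (s : ℕ) :
    qcms X s ≤ qcms Xs s + rhoDist X Xs s := by
  haveI : Nonempty {x : EuclideanSpace ℝ (Fin N) // ‖x‖ = 1} :=
    ⟨⟨EuclideanSpace.single ⟨0, hN⟩ 1, by simp⟩⟩
  rw [← sub_le_iff_le_add]
  refine le_ciInf fun x => ?_
  rw [sub_le_iff_le_add]
  refine le_trans (ciInf_le ⟨0, ?_⟩ x) (aux_sSup_le hO hOs s x.2)
  rintro _ ⟨y, rfl⟩
  exact Real.sSup_nonneg fun ρ hρ => hρ.1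

end helpers

/-- For any two O-families `𝒳` and `𝒳*` and any `s ∈ 𝒮`,
`|qcm_s(𝒳*) − qcm_s(𝒳)| ≤ ρ_s(𝒳, 𝒳*)`. -/
theorem abs_qcms_sub_qcms_le {N : ℕ} (hN : 1 ≤ N)
    (X Xs : Set (ℕ → EuclideanSpace ℝ (Fin N))) (hO : IsOFamily X) (hOs : IsOFamily Xs)
    (s : ℕ) (hs : N ≤ s + 1) :
    |qcms Xs s - qcms X s| ≤ rhoDist X Xs s := by
  rw [abs_sub_le_iff]
  have h1 := aux_qcms_le hN hO hOs s
  have h2 := aux_qcms_le hN hOs hO s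
  rw [aux_rho_comm] at h2
  constructor <;> linarith
end

section
/- Let a sequence of O-families 𝒳ₙ in ℝ^N converge to a quasi-controllable O-family 𝒳. Then 𝒳ₙ is quasi-controllable for all sufficiently large n, and for each s ∈ 𝒮 one has lim_{n→∞} qcm_s(𝒳ₙ) = qcm_s(𝒳). -/
open Set Filter Metric Pointwise

section Helpers

variable {V : Type*} [NormedAddCommGroup V]

theorem fs_nonempty [NormedSpace ℝ V] {X : Set (ℕ → V)} (h : IsOFamily X) (u : V) (t : ℕ) :
    (famSet X u t 0).Nonempty := by
  obtain ⟨x, hx⟩ := h.nonempty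
  have h1 : (famSet X (x 0) t 0).Nonempty := ⟨x t, x, hx, rfl, rfl⟩
  have h2 : (famSet X ((0 : ℝ) • x 0) t 0).Nonempty := by
    rw [h.homog]; exact h1.smul_set
  rw [zero_smul, ← zero_smul ℝ u, h.homog] at h2
  exact Set.smul_set_nonempty.mp h2

theorem fs_add [NormedSpace ℝ V] {X : Set (ℕ → V)} (h : IsOFamily X) (u v : V) (t : ℕ) {y : V}
    (hy : y ∈ famSet X (u + v) t 0) :
    ∃ a ∈ famSet X u t 0, ∃ b ∈ famSet X v t 0, y = a + b := by
  have e : u + v = (2 : ℝ) • ((1 / 2 : ℝ) • u + (1 - 1 / 2 : ℝ) • v) := by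
    module
  rw [e, h.homog] at hy
  obtain ⟨w, hw, rfl⟩ := hy
  obtain ⟨p, ⟨a, ha, rfl⟩, q, ⟨b, hb, rfl⟩, rfl⟩ :=
    h.concave (by norm_num) (by norm_num) u v t hw
  refine ⟨a, ha, b, hb, ?_⟩
  simp only
  module

theorem fs_smul [NormedSpace ℝ V] {X : Set (ℕ → V)} (h : IsOFamily X) (l : ℝ) (u : V) (t : ℕ)
    {y : V} (hy : y ∈ famSet X (l • u) t 0) : ∃ a ∈ famSet X u t 0, y = l • a := by
  rw [h.homog] at hy
  obtain ⟨w, hw, rfl⟩ := hy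
  exact ⟨w, hw, rfl⟩

theorem fs_zero [NormedSpace ℝ V] {X : Set (ℕ → V)} (h : IsOFamily X) (t : ℕ)
    {y : V} (hy : y ∈ famSet X 0 t 0) : y = 0 := by
  rw [← zero_smul ℝ (0 : V)] at hy
  obtain ⟨a, -, rfl⟩ := fs_smul h _ _ _ hy
  simp

theorem fs_init [NormedSpace ℝ V] {X : Set (ℕ → V)} (h : IsOFamily X) (u : V) :
    u ∈ famSet X u 0 0 := by
  obtain ⟨y, x, hx, h0, rfl⟩ := fs_nonempty h u 0
  exact ⟨x, hx, h0, h0⟩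

theorem fs_bound1 [NormedSpace ℝ V] {X : Set (ℕ → V)} (h : IsOFamily X) (t : ℕ) :
    ∃ B : ℝ, 0 ≤ B ∧ ∀ u : V, ∀ y ∈ famSet X u t 0, ‖y‖ ≤ B * ‖u‖ := by
  obtain ⟨ρ, hρ⟩ := h.locBdd t
  refine ⟨max ρ 0, le_max_right _ _, fun u y hy => ?_⟩
  rcases eq_or_ne u 0 with rfl | hu
  · simp [fs_zero h t hy]
  · have hu' : ‖u‖ ≠ 0 := norm_ne_zero_iff.mpr hu
    have e : u = ‖u‖ • (‖u‖⁻¹ • u) := by rw [smul_smul, mul_inv_cancel₀ hu', one_smul]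
    rw [e] at hy
    obtain ⟨a, ha, rfl⟩ := fs_smul h _ _ _ hy
    have := hρ _ (by rw [norm_smul, norm_inv, norm_norm, inv_mul_cancel₀ hu']) a ha
    rw [norm_smul, norm_norm, mul_comm]
    gcongr
    exact this.trans (le_max_left _ _)

theorem fs_sum [NormedSpace ℝ V] {X : Set (ℕ → V)} (h : IsOFamily X) (t : ℕ) {ι : Type*}
    (S : Finset ι) (u : ι → V) (b : ι → ℝ) (hb : ∀ i, ∀ y ∈ famSet X (u i) t 0, ‖y‖ ≤ b i) :
    ∀ y ∈ famSet X (∑ i ∈ S, u i) t 0, ‖y‖ ≤ ∑ i ∈ S, b i := by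
  classical
  induction S using Finset.induction_on with
  | empty => intro y hy; simp at hy; simp [fs_zero h t hy]
  | insert i S hi ih =>
    intro y hy
    rw [Finset.sum_insert hi] at hy ⊢
    obtain ⟨a, ha, c, hc, rfl⟩ := fs_add h _ _ _ hy
    exact (norm_add_le _ _).trans (add_le_add (hb i a ha) (ih c hc))

theorem fs_trans [NormedSpace ℝ V] {X : Set (ℕ → V)} (h : IsOFamily X) {x w y : V} {s t : ℕ}
    (hw : w ∈ famSet X x s 0) (hy : y ∈ famSet X w t 0) : y ∈ famSet X x (s + t) 0 := by
  have hy' : y ∈ famSet X w (s + t) s := by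
    rw [h.timeInv w (Nat.le_add_right s t)]; simpa using hy
  obtain ⟨p, hp, hp0, hps⟩ := hw
  obtain ⟨q, hq, hq0, hqs⟩ := hy'
  obtain ⟨z, hz, h1, h2⟩ := h.sewing (Nat.zero_le s) (Nat.le_add_right s t) p hp q hq
    (hps.trans hq0.symm)
  exact ⟨z, hz, by rw [h1 0 le_rfl (Nat.zero_le _), hp0],
    by rw [h2 _ (Nat.le_add_right _ _) le_rfl, hqs]⟩

theorem fs_span_top [NormedSpace ℝ V] {X : Set (ℕ → V)} (h : IsOFamily X)
    (hq : QuasiControllable X) {x : V} (hx : x ≠ 0) :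
    Submodule.span ℝ (⋃ t, famSet X x t 0) = ⊤ := by
  by_contra hne
  apply hq
  refine ⟨_, ?_, hne, ?_⟩
  · intro hb
    have : x ∈ Submodule.span ℝ (⋃ t, famSet X x t 0) :=
      Submodule.subset_span (Set.mem_iUnion.2 ⟨0, fs_init h x⟩)
    rw [hb] at this
    exact hx (by simpa using this)
  · intro u hu t
    induction hu using Submodule.span_induction with
    | mem w hw =>
      obtain ⟨r, hr⟩ := Set.mem_iUnion.1 hw
      intro y hy
      exact Submodule.subset_span (Set.mem_iUnion.2 ⟨r + t, fs_trans h hr hy⟩)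
    | zero => intro y hy; rw [fs_zero h t hy]; exact Submodule.zero_mem _
    | add a b _ _ iha ihb =>
      intro y hy
      obtain ⟨p, hp, q, hq, rfl⟩ := fs_add h _ _ _ hy
      exact Submodule.add_mem _ (iha hp) (ihb hq)
    | smul c a _ iha =>
      intro y hy
      obtain ⟨p, hp, rfl⟩ := fs_smul h _ _ _ hy
      exact Submodule.smul_mem _ _ (iha hp)

/-- one-sided approximation -/
theorem fs_close [NormedSpace ℝ V] {Xn : ℕ → Set (ℕ → V)} {X : Set (ℕ → V)}
    (hOn : ∀ n, IsOFamily (Xn n)) (hO : IsOFamily X) (hc : OFamTendsto Xn X) (x : V) (t : ℕ)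
    {ε : ℝ} (hε : 0 < ε) :
    ∀ᶠ n in atTop, (∀ y ∈ famSet (Xn n) x t 0, ∃ z ∈ famSet X x t 0, dist y z < ε) ∧
      (∀ z ∈ famSet X x t 0, ∃ y ∈ famSet (Xn n) x t 0, dist z y < ε) := by
  filter_upwards [(hc x t).eventually_lt_const hε] with n hn
  have hbd : ∀ {Y : Set (ℕ → V)}, IsOFamily Y → Bornology.IsBounded (famSet Y x t 0) := by
    intro Y hY
    obtain ⟨B, -, hB⟩ := fs_bound1 hY t
    exact isBounded_iff_forall_norm_le.2 ⟨_, fun y hy => hB x y hy⟩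
  have h1 : hausdorffDist (famSet (Xn n) x t 0) (famSet X x t 0) < ε := by
    rw [← hausdorffDist_closure]
    refine lt_of_le_of_lt ?_ hn
    exact le_ciSup (f := fun t : Fin (t + 1) =>
      hausdorffDist (closure (famSet (Xn n) x (t : ℕ) 0)) (closure (famSet X x (t : ℕ) 0)))
      (Set.finite_range _).bddAbove (Fin.last t)
  have hfin := hausdorffEDist_ne_top_of_nonempty_of_bounded (fs_nonempty (hOn n) x t)
    (fs_nonempty hO x t) (hbd (hOn n)) (hbd hO)
  refine ⟨fun y hy => exists_dist_lt_of_hausdorffDist_lt hy h1 hfin, fun z hz => ?_⟩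
  obtain ⟨y, hy, hd⟩ := exists_dist_lt_of_hausdorffDist_lt' hz h1 hfin
  exact ⟨y, hy, by rwa [dist_comm]⟩

variable [InnerProductSpace ℝ V] [FiniteDimensional ℝ V]

theorem fs_ubound {Xn : ℕ → Set (ℕ → V)} {X : Set (ℕ → V)}
    (hOn : ∀ n, IsOFamily (Xn n)) (hO : IsOFamily X) (hc : OFamTendsto Xn X) (t : ℕ) :
    ∃ B : ℝ, 0 < B ∧ (∀ u : V, ∀ y ∈ famSet X u t 0, ‖y‖ ≤ B * ‖u‖) ∧
      ∀ᶠ n in atTop, ∀ u : V, ∀ y ∈ famSet (Xn n) u t 0, ‖y‖ ≤ B * ‖u‖ := by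
  obtain ⟨B, hB0, hB⟩ := fs_bound1 hO t
  let b := stdOrthonormalBasis ℝ V
  let d : ℝ := Module.finrank ℝ V
  refine ⟨(d + 1) * (B + 1), by positivity, ?_, ?_⟩
  · intro u y hy
    refine (hB u y hy).trans ?_
    gcongr
    have : (0 : ℝ) ≤ d := by positivity
    nlinarith
  · have key : ∀ᶠ n in atTop, ∀ i, ∀ y ∈ famSet (Xn n) (b i) t 0, ‖y‖ ≤ B + 1 := by
      rw [Filter.eventually_all]
      intro i
      filter_upwards [fs_close hOn hO hc (b i) t one_pos] with n hn y hy
      obtain ⟨z, hz, hd⟩ := hn.1 y hy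
      have h1 := hB _ z hz
      rw [b.norm_eq_one, mul_one] at h1
      rw [dist_eq_norm] at hd
      have := norm_le_norm_add_norm_sub' y z
      linarith
    filter_upwards [key] with n hn u y hy
    have h2 := fs_sum (hOn n) t Finset.univ (fun i => b.repr u i • b i)
      (fun _ => ‖u‖ * (B + 1)) ?_ y (by rwa [b.sum_repr u])
    · refine h2.trans ?_
      rw [Finset.sum_const, nsmul_eq_mul, Finset.card_univ, Fintype.card_fin]
      have : 0 ≤ ‖u‖ * (B + 1) := by positivity
      simp only [d]
      nlinarith
    · intro i y hy
      obtain ⟨a, ha, rfl⟩ := fs_smul (hOn n) _ _ _ hy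
      rw [norm_smul]
      gcongr
      · rw [b.repr_apply_apply]
        simpa [b.norm_eq_one] using norm_inner_le_norm (𝕜 := ℝ) (b i) u
      · exact hn i a ha

/-- Lipschitz -/
theorem fs_lip {X : Set (ℕ → V)} (hO : IsOFamily X) {t : ℕ} {B : ℝ}
    (hB : ∀ u : V, ∀ y ∈ famSet X u t 0, ‖y‖ ≤ B * ‖u‖) (u v : V) {y : V}
    (hy : y ∈ famSet X u t 0) : ∃ z ∈ famSet X v t 0, dist y z ≤ B * dist u v := by
  rw [← add_sub_cancel v u] at hy
  obtain ⟨a, ha, b, hb, rfl⟩ := fs_add hO _ _ _ hy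
  exact ⟨a, ha, by simpa [dist_eq_norm] using hB _ b hb⟩

theorem fs_unif {Xn : ℕ → Set (ℕ → V)} {X : Set (ℕ → V)}
    (hOn : ∀ n, IsOFamily (Xn n)) (hO : IsOFamily X) (hc : OFamTendsto Xn X) (t : ℕ)
    {ε : ℝ} (hε : 0 < ε) :
    ∀ᶠ n in atTop, ∀ x : V, ‖x‖ = 1 →
      (∀ y ∈ famSet (Xn n) x t 0, ∃ z ∈ famSet X x t 0, dist y z < ε) ∧
      (∀ z ∈ famSet X x t 0, ∃ y ∈ famSet (Xn n) x t 0, dist z y < ε) := by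
  obtain ⟨B, hB0, hB, hBn⟩ := fs_ubound hOn hO hc t
  have hδ : 0 < ε / 3 / B := by positivity
  obtain ⟨T, hT, hTf, hcov⟩ := (isCompact_sphere (0 : V) 1).finite_cover_balls hδ
  have h1 := (Filter.eventually_all_finite hTf).2
    (fun x _ => fs_close hOn hO hc x t (show 0 < ε / 3 by positivity))
  filter_upwards [hBn, h1] with n hn h1 x hx
  have hx' : x ∈ ⋃ p ∈ T, ball p (ε / 3 / B) := hcov (by simpa using hx)
  simp only [Set.mem_iUnion, mem_ball, exists_prop] at hx'
  obtain ⟨p, hp, hd⟩ := hx'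
  rw [lt_div_iff₀ hB0, mul_comm] at hd
  have hd' : B * dist p x < ε / 3 := by rwa [dist_comm]
  constructor
  · intro y hy
    obtain ⟨a, ha, h2⟩ := fs_lip (hOn n) hn x p hy
    obtain ⟨b, hb, h3⟩ := (h1 p hp).1 a ha
    obtain ⟨c, hc, h4⟩ := fs_lip hO hB p x hb
    exact ⟨c, hc, by linarith [dist_triangle4 y a b c]⟩
  · intro y hy
    obtain ⟨a, ha, h2⟩ := fs_lip hO hB x p hy
    obtain ⟨b, hb, h3⟩ := (h1 p hp).2 a ha
    obtain ⟨c, hc, h4⟩ := fs_lip (hOn n) hn p x hb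
    exact ⟨c, hc, by linarith [dist_triangle4 y a b c]⟩

theorem ball_subset_of_closure {C : Set V} (hC : Convex ℝ C) {r : ℝ} (hr : 0 < r)
    (h : ball (0 : V) r ⊆ closure C) : ball (0 : V) r ⊆ C := by
  have hi : (interior C).Nonempty := by
    rw [hC.interior_nonempty_iff_affineSpan_eq_top]
    have h1 : closure C ⊆ (affineSpan ℝ C : Set V) :=
      closure_minimal (subset_affineSpan ℝ C) (AffineSubspace.closed_of_finiteDimensional _)
    have h2 : affineSpan ℝ (ball (0 : V) r) = ⊤ :=
      isOpen_ball.affineSpan_eq_top ⟨0, mem_ball_self hr⟩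
    rw [eq_top_iff, ← h2]
    exact affineSpan_le.2 (h.trans h1)
  rw [← isOpen_ball.subset_interior_iff, hC.interior_closure_eq_interior_of_nonempty_interior hi] at h
  exact h.trans interior_subset

theorem absco_ball {W W' : Set V} {ε ρ : ℝ} (hρ : ε < ρ) (hρ0 : 0 ≤ ρ)
    (hW : ∀ y ∈ W, ∃ z ∈ W', dist y z ≤ ε)
    (h : closedBall (0 : V) ρ ⊆ absco W) : ball (0 : V) (ρ - ε) ⊆ absco W' := by
  refine ball_subset_of_closure (convex_convexHull ℝ _) (by linarith) ?_
  intro y hy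
  by_contra hyn
  obtain ⟨f, u, hf, hu⟩ := geometric_hahn_banach_closed_point
    (convex_convexHull ℝ _).closure isClosed_closure hyn
  obtain ⟨v, rfl⟩ := (InnerProductSpace.toDual ℝ V).surjective f
  simp only [InnerProductSpace.toDual_apply_apply] at hf hu
  have hu0 : inner ℝ v y ≤ ‖v‖ * ‖y‖ := real_inner_le_norm v y
  have hv : v ≠ 0 := by
    rintro rfl
    have hne : (absco W').Nonempty := by
      have h0 : (0 : V) ∈ absco W := h (by simpa using hρ0)
      have : (W ∪ -W).Nonempty := convexHull_nonempty_iff.1 ⟨0, h0⟩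
      obtain ⟨w, hw⟩ := this
      rcases hw with hw | hw
      · obtain ⟨z, hz, -⟩ := hW w hw
        exact ⟨z, subset_convexHull ℝ _ (Or.inl hz)⟩
      · obtain ⟨z, hz, -⟩ := hW _ hw
        exact ⟨z, subset_convexHull ℝ _ (Or.inl hz)⟩
    obtain ⟨z, hz⟩ := hne
    have := hf z (subset_closure hz)
    simp at this hu
    linarith
  have hvp : 0 < ‖v‖ := norm_pos_iff.2 hv
  -- all of absco W is in a half space
  have hsub : absco W ⊆ {w | inner ℝ v w ≤ u + ‖v‖ * ε} := by
    refine convexHull_min ?_ ?_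
    · have aux : ∀ p q : V, dist p q ≤ ε → inner ℝ v q < u → inner ℝ v p ≤ u + ‖v‖ * ε := by
        intro p q hd hq
        have h1 := real_inner_le_norm v (p - q)
        rw [inner_sub_right, ← dist_eq_norm] at h1
        nlinarith
      rintro w (hw | hw)
      · obtain ⟨z, hz, hd⟩ := hW w hw
        exact aux w z hd (hf z (subset_closure (subset_convexHull ℝ _ (Or.inl hz))))
      · obtain ⟨z, hz, hd⟩ := hW _ hw
        refine aux w (-z) (by rwa [← dist_neg_neg, neg_neg]) (hf _ (subset_closure (subset_convexHull ℝ _ (Or.inr ?_))))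
        simpa using hz
    · exact convex_halfSpace_le (innerSL ℝ v).toLinearMap.isLinear _
  have hm : (ρ / ‖v‖) • v ∈ closedBall (0 : V) ρ := by
    rw [mem_closedBall_zero_iff, norm_smul, Real.norm_eq_abs, abs_of_nonneg (by positivity),
      div_mul_cancel₀ _ hvp.ne']
  have h3 := hsub (h hm)
  simp only [Set.mem_ofPred_eq, inner_smul_right, real_inner_self_eq_norm_sq] at h3
  have h4 : ρ / ‖v‖ * ‖v‖ ^ 2 = ρ * ‖v‖ := by field_simp
  rw [h4] at h3
  rw [mem_ball_zero_iff] at hy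
  nlinarith

theorem absco_zero_mem {W : Set V} (hW : W.Nonempty) : (0 : V) ∈ absco W := by
  obtain ⟨w, hw⟩ := hW
  have h1 : w ∈ absco W := subset_convexHull ℝ _ (Or.inl hw)
  have h2 : -w ∈ absco W := subset_convexHull ℝ _ (Or.inr (by simpa using hw))
  have := (convex_convexHull ℝ (W ∪ -W)) h1 h2 (a := 1 / 2) (b := 1 / 2) (by norm_num)
    (by norm_num) (by norm_num)
  rwa [smul_neg, add_neg_cancel] at this

theorem absco_bddAbove [Nontrivial V] {W : Set V} (hW : Bornology.IsBounded W) :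
    BddAbove {ρ : ℝ | 0 ≤ ρ ∧ closedBall (0 : V) ρ ⊆ absco W} := by
  have h1 : Bornology.IsBounded (absco W) := by
    unfold absco
    rw [isBounded_convexHull]
    exact hW.union hW.neg
  obtain ⟨R, hR⟩ := isBounded_iff_forall_norm_le.1 h1
  refine ⟨R, fun ρ hρ => ?_⟩
  obtain ⟨x, hx⟩ := exists_norm_eq V (c := ρ) hρ.1
  have := hR x (hρ.2 (by simp [hx]))
  linarith

theorem absco_sSup_le [Nontrivial V] {W W' : Set V} {ε : ℝ} (hε : 0 ≤ ε)
    (hne : W.Nonempty) (hbd : Bornology.IsBounded W')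
    (hW : ∀ y ∈ W, ∃ z ∈ W', dist y z ≤ ε) :
    sSup {ρ : ℝ | 0 ≤ ρ ∧ closedBall (0 : V) ρ ⊆ absco W} ≤
      sSup {ρ : ℝ | 0 ≤ ρ ∧ closedBall (0 : V) ρ ⊆ absco W'} + ε := by
  have hbd' := absco_bddAbove hbd
  have hs0 : 0 ≤ sSup {ρ : ℝ | 0 ≤ ρ ∧ closedBall (0 : V) ρ ⊆ absco W'} :=
    Real.sSup_nonneg (fun _ h => h.1)
  refine csSup_le ⟨0, le_rfl, by simpa using absco_zero_mem hne⟩ ?_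
  rintro ρ ⟨hρ0, hρ⟩
  rcases le_or_gt ρ ε with h | h
  · linarith
  have hb := absco_ball h hρ0 hW hρ
  rw [← sub_le_iff_le_add]
  refine le_of_forall_lt_imp_le_of_dense fun r hr => ?_
  rcases le_or_gt r 0 with h0 | h0
  · linarith
  exact le_csSup hbd' ⟨h0.le, (closedBall_subset_ball hr).trans hb⟩

theorem W_bdd {X : Set (ℕ → V)} (hO : IsOFamily X) (x : V) (s : ℕ) :
    Bornology.IsBounded (⋃ t ≤ s, famSet X x t 0) := by
  refine (Bornology.isBounded_biUnion (Set.finite_Iic s)).2 fun t _ => ?_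
  obtain ⟨B, -, hB⟩ := fs_bound1 hO t
  exact isBounded_iff_forall_norm_le.2 ⟨_, fun y hy => hB x y hy⟩

theorem W_ne {X : Set (ℕ → V)} (hO : IsOFamily X) (x : V) (s : ℕ) :
    (⋃ t ≤ s, famSet X x t 0).Nonempty :=
  ⟨x, Set.mem_biUnion (Nat.zero_le s) (fs_init hO x)⟩

theorem qcms_le [Nontrivial V] {X Y : Set (ℕ → V)} (hX : IsOFamily X) (hY : IsOFamily Y) (s : ℕ)
    {ε : ℝ} (hε : 0 ≤ ε)
    (h : ∀ t ≤ s, ∀ x : V, ‖x‖ = 1 → ∀ y ∈ famSet X x t 0, ∃ z ∈ famSet Y x t 0, dist y z < ε) :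
    qcms X s ≤ qcms Y s + ε := by
  obtain ⟨x₀, hx₀⟩ := exists_norm_eq V (c := 1) zero_le_one
  haveI : Nonempty {x : V // ‖x‖ = 1} := ⟨⟨x₀, hx₀⟩⟩
  unfold qcms
  rw [← sub_le_iff_le_add]
  refine le_ciInf fun x => ?_
  rw [sub_le_iff_le_add]
  refine (ciInf_le ⟨0, ?_⟩ x).trans (absco_sSup_le hε (W_ne hX _ s) (W_bdd hY _ s) ?_)
  · rintro _ ⟨y, rfl⟩
    exact Real.sSup_nonneg (fun _ h => h.1)
  · intro y hy
    simp only [Set.mem_iUnion, exists_prop] at hy ⊢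
    obtain ⟨t, ht, hy⟩ := hy
    obtain ⟨z, hz, hd⟩ := h t ht x x.2 y hy
    exact ⟨z, ⟨t, ht, hz⟩, hd.le⟩

theorem qcms_tendsto [Nontrivial V] {Xn : ℕ → Set (ℕ → V)} {X : Set (ℕ → V)}
    (hOn : ∀ n, IsOFamily (Xn n)) (hO : IsOFamily X) (hc : OFamTendsto Xn X) (s : ℕ) :
    Tendsto (fun n => qcms (Xn n) s) atTop (nhds (qcms X s)) := by
  rw [tendsto_order]
  have key : ∀ ε > 0, ∀ᶠ n in atTop, qcms (Xn n) s ≤ qcms X s + ε ∧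
      qcms X s ≤ qcms (Xn n) s + ε := by
    intro ε hε
    filter_upwards [(Filter.eventually_all_finite (Set.finite_Iic s)).2
      (fun t _ => fs_unif hOn hO hc t hε)] with n hn
    exact ⟨qcms_le (hOn n) hO s hε.le fun t ht x hx => (hn t ht x hx).1,
      qcms_le hO (hOn n) s hε.le fun t ht x hx => (hn t ht x hx).2⟩
  constructor
  · intro a ha
    filter_upwards [key ((qcms X s - a) / 2) (by linarith)] with n hn
    linarith [hn.2]
  · intro a ha
    filter_upwards [key ((a - qcms X s) / 2) (by linarith)] with n hn
    linarith [hn.1]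

theorem qc_eventually {Xn : ℕ → Set (ℕ → V)} {X : Set (ℕ → V)}
    (hOn : ∀ n, IsOFamily (Xn n)) (hO : IsOFamily X) (hc : OFamTendsto Xn X)
    (hq : QuasiControllable X) : ∀ᶠ n in atTop, QuasiControllable (Xn n) := by
  by_contra hcon
  rw [Filter.not_eventually] at hcon
  obtain ⟨φ, hφ, hbad⟩ := Filter.extraction_of_frequently_atTop hcon
  have hpt : ∀ k, ∃ p : V × V, p ∈ sphere (0 : V) 1 ×ˢ sphere (0 : V) 1 ∧
      ∀ t, ∀ y ∈ famSet (Xn (φ k)) p.1 t 0, inner ℝ p.2 y = 0 := by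
    intro k
    obtain ⟨E, hE0, hE1, hE⟩ := not_not.1 (hbad k)
    have unit : ∀ F : Submodule ℝ V, F ≠ ⊥ → ∃ x ∈ F, ‖x‖ = 1 := by
      intro F hF
      obtain ⟨x, hx, hx0⟩ := Submodule.exists_mem_ne_zero_of_ne_bot hF
      exact ⟨‖x‖⁻¹ • x, F.smul_mem _ hx, by
        rw [norm_smul, norm_inv, norm_norm, inv_mul_cancel₀ (norm_ne_zero_iff.2 hx0)]⟩
    obtain ⟨x, hx, hx1⟩ := unit E hE0
    obtain ⟨v, hv, hv1⟩ := unit Eᗮ (fun h => hE1 (Submodule.orthogonal_eq_bot_iff.1 h))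
    refine ⟨(x, v), by simp [hx1, hv1], fun t y hy => ?_⟩
    exact Submodule.inner_left_of_mem_orthogonal (hE x hx t hy) hv
  choose p hp hpo using hpt
  obtain ⟨⟨x, v⟩, hxv, ψ, hψ, hlim⟩ :=
    ((isCompact_sphere (0 : V) 1).prod (isCompact_sphere (0 : V) 1)).tendsto_subseq hp
  have hx1 : ‖x‖ = 1 := by simpa using hxv.1
  have hv1 : ‖v‖ = 1 := by simpa using hxv.2
  have hlx : Tendsto (fun k => (p (ψ k)).1) atTop (nhds x) := (continuous_fst.tendsto _).comp hlim
  have hlv : Tendsto (fun k => (p (ψ k)).2) atTop (nhds v) := (continuous_snd.tendsto _).comp hlim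
  have hτ : Tendsto (fun k => φ (ψ k)) atTop atTop := (hφ.comp hψ).tendsto_atTop
  have horth : ∀ t, ∀ y ∈ famSet X x t 0, inner ℝ v y = 0 := by
    intro t y hy
    obtain ⟨B, hB0, hB, hBn⟩ := fs_ubound hOn hO hc t
    have hl : Tendsto (fun k => inner ℝ (p (ψ k)).2 y) atTop (nhds (inner ℝ v y)) :=
      hlv.inner tendsto_const_nhds
    refine tendsto_nhds_unique hl ?_
    rw [Metric.tendsto_nhds]
    intro ε hε
    have hB2 : 0 < ε / 2 / B := by positivity
    filter_upwards [hτ.eventually hBn,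
      hτ.eventually (fs_close hOn hO hc x t (show 0 < ε / 2 by positivity)),
      Metric.tendsto_nhds.1 hlx _ hB2] with k h1 h2 h3
    obtain ⟨a, ha, hya⟩ := h2.2 y hy
    obtain ⟨b, hb, hab⟩ := fs_lip (hOn _) h1 x (p (ψ k)).1 ha
    have h0 := hpo (ψ k) t b hb
    have hn : ‖(p (ψ k)).2‖ = 1 := by simpa using (hp (ψ k)).2
    have h5 := norm_inner_le_norm (𝕜 := ℝ) (p (ψ k)).2 (y - b)
    rw [inner_sub_right, h0, hn, one_mul, ← dist_eq_norm y b] at h5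
    rw [lt_div_iff₀ hB0] at h3
    rw [dist_eq_norm (inner ℝ (p (ψ k)).2 y)]
    rw [mul_comm, dist_comm] at h3
    linarith [dist_triangle y a b]
  have hspan := fs_span_top hO hq (x := x) (by rintro rfl; simp at hx1)
  have : v ∈ (Submodule.span ℝ (⋃ t, famSet X x t 0))ᗮ := by
    rw [Submodule.mem_orthogonal']
    intro u hu
    induction hu using Submodule.span_induction with
    | mem w hw =>
      obtain ⟨r, hr⟩ := Set.mem_iUnion.1 hw
      exact horth r w hr
    | zero => simp
    | add a b _ _ iha ihb => rw [inner_add_right, iha, ihb, add_zero]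
    | smul c a _ iha => rw [inner_smul_right, iha, mul_zero]
  rw [hspan, Submodule.top_orthogonal_eq_bot, Submodule.mem_bot] at this
  rw [this] at hv1
  simp at hv1

end Helpers

/-- If O-families `𝒳ₙ` converge to a quasi-controllable O-family `𝒳`, then `𝒳ₙ` is
quasi-controllable for all sufficiently large `n`, and `qcm_s(𝒳ₙ) → qcm_s(𝒳)` for
each `s ∈ 𝒮`. -/
theorem quasiControllable_robust {N : ℕ} (hN : 1 ≤ N)
    (Xn : ℕ → Set (ℕ → EuclideanSpace ℝ (Fin N))) (X : Set (ℕ → EuclideanSpace ℝ (Fin N)))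
    (hOn : ∀ n, IsOFamily (Xn n)) (hO : IsOFamily X)
    (hconv : OFamTendsto Xn X) (hqc : QuasiControllable X) :
    (∀ᶠ n in Filter.atTop, QuasiControllable (Xn n)) ∧
      ∀ s : ℕ, N ≤ s + 1 →
        Filter.Tendsto (fun n => qcms (Xn n) s) Filter.atTop (nhds (qcms X s)) := by
  haveI : Nonempty (Fin N) := ⟨⟨0, hN⟩⟩
  haveI : Nontrivial (EuclideanSpace ℝ (Fin N)) := inferInstance
  exact ⟨qc_eventually hOn hO hconv hqc, fun s _ => qcms_tendsto hOn hO hconv s⟩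
end

section
/- Let a sequence of Lyapunov stable O-families 𝒳ₙ in ℝ^N converge to a quasi-controllable O-family 𝒳. Then 𝒳 is also Lyapunov stable. -/
open Set Filter Metric Pointwise

section helpers

variable {V : Type*} [NormedAddCommGroup V] [NormedSpace ℝ V]

lemma unit_norm_aux {v : V} (hv : v ≠ 0) : ‖‖v‖⁻¹ • v‖ = 1 := by
  rw [norm_smul, norm_inv, norm_norm, inv_mul_cancel₀ (norm_ne_zero_iff.2 hv)]

lemma famSet_nonempty' {X : Set (ℕ → V)} (h : IsOFamily X) (u : V) (t : ℕ) :
    (famSet X u t 0).Nonempty := by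
  obtain ⟨x, hx⟩ := h.nonempty
  have h0 : (0 : V) ∈ famSet X 0 t 0 := by
    have := h.homog 0 (x 0) t
    rw [zero_smul] at this
    rw [this]
    exact ⟨x t, ⟨x, hx, rfl, rfl⟩, by simp⟩
  have hc := h.concave (l := 1/2) (by norm_num) (by norm_num) u (-u) t
  have he : (1/2 : ℝ) • u + (1 - 1/2 : ℝ) • (-u) = 0 := by
    rw [smul_neg]; norm_num
  rw [he] at hc
  obtain ⟨a, ⟨b, hb, _⟩, _⟩ := hc h0
  exact ⟨b, hb⟩

lemma famSet_zero_time {X : Set (ℕ → V)} (h : IsOFamily X) (u : V) :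
    u ∈ famSet X u 0 0 := by
  obtain ⟨y, x, hx, h1, h2⟩ := famSet_nonempty' h u 0
  exact ⟨x, hx, h1, h1⟩

lemma famSet_add {X : Set (ℕ → V)} (h : IsOFamily X) (u v : V) (t : ℕ) :
    famSet X (u + v) t 0 ⊆ famSet X u t 0 + famSet X v t 0 := by
  have hc := h.concave (l := 1/2) (by norm_num) (by norm_num) ((2:ℝ) • u) ((2:ℝ) • v) t
  rw [h.homog, h.homog, smul_smul, smul_smul, smul_smul, smul_smul] at hc
  norm_num at hc
  exact hc

lemma famSet_trans {X : Set (ℕ → V)} (h : IsOFamily X) {v w z : V} {s t : ℕ}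
    (hw : w ∈ famSet X v s 0) (hz : z ∈ famSet X w t 0) : z ∈ famSet X v (s + t) 0 := by
  have h1 := h.timeInv w (Nat.le_add_right s t)
  rw [Nat.add_sub_cancel_left] at h1
  rw [← h1] at hz
  obtain ⟨x, hx, hx0, hxs⟩ := hw
  obtain ⟨y, hy, hys, hyt⟩ := hz
  obtain ⟨q, hq, hq1, hq2⟩ := h.sewing (Nat.zero_le s) (Nat.le_add_right s t) x hx y hy
    (hxs.trans hys.symm)
  exact ⟨q, hq, (hq1 0 le_rfl (Nat.zero_le s)).trans hx0,
    (hq2 (s + t) (Nat.le_add_right s t) le_rfl).trans hyt⟩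

lemma famSet_bdd {X : Set (ℕ → V)} (h : IsOFamily X) (u : V) (t : ℕ) :
    Bornology.IsBounded (famSet X u t 0) := by
  obtain ⟨ρ, hρ⟩ := h.locBdd t
  by_cases hu : u = 0
  · have := h.homog 0 u t
    rw [zero_smul, zero_smul_set (famSet_nonempty' h u t)] at this
    rw [hu, this]
    exact Bornology.isBounded_singleton
  · have hb : Bornology.IsBounded (famSet X (‖u‖⁻¹ • u) t 0) := by
      rw [isBounded_iff_forall_norm_le]
      exact ⟨ρ, fun y hy => hρ _ (unit_norm_aux hu) y hy⟩
    have := h.homog ‖u‖ (‖u‖⁻¹ • u) t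
    rw [smul_smul, mul_inv_cancel₀ (norm_ne_zero_iff.2 hu), one_smul] at this
    rw [this]
    exact hb.smul₀ _

lemma core [Nontrivial V] {X : Set (ℕ → V)} (h : IsOFamily X) (hs : LyapunovStable X) :
    ∃ (p : V → ℝ) (C : ℝ) (a b : V), (∀ v, ‖v‖ ≤ p v) ∧ (∀ u v, p (u + v) ≤ p u + p v) ∧
      (∀ (c : ℝ) v, p (c • v) ≤ |c| * p v) ∧
      (∀ v t, ∀ w ∈ famSet X v t 0, p w ≤ p v) ∧ (∀ v, p v ≤ C * ‖v‖) ∧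
      ‖a‖ = 1 ∧ C / 2 ≤ p a ∧ ‖b‖ = 1 ∧ p b ≤ 2 := by
  obtain ⟨μ, hμ, hst⟩ := hs
  let S : V → Set ℝ := fun v => {r | ∃ t, ∃ w ∈ famSet X v t 0, r = ‖w‖}
  have hSn : ∀ v, (S v).Nonempty := fun v => ⟨‖v‖, 0, v, famSet_zero_time h v, rfl⟩
  have hSb : ∀ v, BddAbove (S v) := by
    intro v
    refine ⟨μ * ‖v‖, ?_⟩
    rintro r ⟨t, w, hw, rfl⟩
    exact hst v t w hw
  let p : V → ℝ := fun v => sSup (S v)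
  have hle : ∀ v t, ∀ w ∈ famSet X v t 0, ‖w‖ ≤ p v := fun v t w hw =>
    le_csSup (hSb v) ⟨t, w, hw, rfl⟩
  have hsup : ∀ v B, (∀ t, ∀ w ∈ famSet X v t 0, ‖w‖ ≤ B) → p v ≤ B := by
    intro v B hB
    refine csSup_le (hSn v) ?_
    rintro r ⟨t, w, hw, rfl⟩
    exact hB t w hw
  have h1 : ∀ v, ‖v‖ ≤ p v := fun v => hle v 0 v (famSet_zero_time h v)
  have h3 : ∀ (c : ℝ) v, p (c • v) ≤ |c| * p v := by
    intro c v
    apply hsup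
    intro t w hw
    rw [h.homog] at hw
    obtain ⟨y, hy, rfl⟩ := hw
    simp only [norm_smul, Real.norm_eq_abs]
    exact mul_le_mul_of_nonneg_left (hle v t y hy) (abs_nonneg c)
  have h4 : ∀ v t, ∀ w ∈ famSet X v t 0, p w ≤ p v := by
    intro v t w hw
    apply hsup
    intro s z hz
    exact hle v _ z (famSet_trans h hw hz)
  have hμp : ∀ v, p v ≤ μ * ‖v‖ := fun v => hsup _ _ fun t w hw => hst v t w hw
  obtain ⟨e, he⟩ := exists_norm_eq V zero_le_one
  let D : Set ℝ := p '' {v | ‖v‖ = 1}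
  have hDn : D.Nonempty := ⟨p e, e, he, rfl⟩
  have hDb : BddAbove D := by
    refine ⟨μ, ?_⟩
    rintro _ ⟨v, hv, rfl⟩
    have := hμp v
    rw [show ‖v‖ = 1 from hv, mul_one] at this
    exact this
  have hC1 : 1 ≤ sSup D := by
    have := h1 e
    rw [he] at this
    exact this.trans (le_csSup hDb ⟨e, he, rfl⟩)
  have h5 : ∀ v, p v ≤ sSup D * ‖v‖ := by
    intro v
    by_cases hv : v = 0
    · simpa [hv] using hμp 0
    · have h6 : p (‖v‖⁻¹ • v) ≤ sSup D := le_csSup hDb ⟨_, unit_norm_aux hv, rfl⟩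
      have h7 := h3 ‖v‖ (‖v‖⁻¹ • v)
      rw [smul_smul, mul_inv_cancel₀ (norm_ne_zero_iff.2 hv), one_smul, abs_norm] at h7
      nlinarith [norm_nonneg v]
  obtain ⟨_, ⟨a, ha, rfl⟩, ha2⟩ := exists_lt_of_lt_csSup hDn (show sSup D / 2 < sSup D by linarith)
  have hpe : 1 ≤ p e := he ▸ h1 e
  obtain ⟨_, ⟨t, y, hy, rfl⟩, hy2⟩ := exists_lt_of_lt_csSup (hSn e) (show p e / 2 < p e by linarith)
  have hy0 : 0 < ‖y‖ := by linarith
  refine ⟨p, sSup D, a, ‖y‖⁻¹ • y, h1, ?_, h3, h4, h5, ha, ha2.le,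
    unit_norm_aux (norm_pos_iff.1 hy0), ?_⟩
  · intro u v
    apply hsup
    intro t w hw
    obtain ⟨a, ha, b, hb, rfl⟩ := famSet_add h u v t hw
    exact (norm_add_le a b).trans (add_le_add (hle u t a ha) (hle v t b hb))
  · refine (h3 _ _).trans ?_
    rw [abs_of_pos (inv_pos.2 hy0), inv_mul_le_iff₀ hy0]
    linarith [h4 e t y hy]

lemma approx {Xn : ℕ → Set (ℕ → V)} {X : Set (ℕ → V)}
    (hOn : ∀ n, IsOFamily (Xn n)) (hO : IsOFamily X) (hconv : OFamTendsto Xn X)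
    {x u : V} {t : ℕ} (hu : u ∈ famSet X x t 0) {ε : ℝ} (hε : 0 < ε) :
    ∀ᶠ n in atTop, ∃ w ∈ famSet (Xn n) x t 0, ‖u - w‖ < ε := by
  filter_upwards [(hconv x t).eventually (gt_mem_nhds hε)] with n hn
  have hlt : hausdorffDist (closure (famSet (Xn n) x t 0)) (closure (famSet X x t 0)) < ε :=
    lt_of_le_of_lt (le_ciSup (f := fun t : Fin (t + 1) =>
      hausdorffDist (closure (famSet (Xn n) x (t : ℕ) 0)) (closure (famSet X x (t : ℕ) 0)))
      (Set.finite_range _).bddAbove (Fin.last t)) hn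
  rw [hausdorffDist_closure, hausdorffDist_comm] at hlt
  obtain ⟨w, hw, hd⟩ := exists_dist_lt_of_hausdorffDist_lt hu hlt
    (hausdorffEDist_ne_top_of_nonempty_of_bounded ⟨u, hu⟩ (famSet_nonempty' (hOn n) x t)
      (famSet_bdd hO x t) (famSet_bdd (hOn n) x t))
  exact ⟨w, hw, by rwa [← dist_eq_norm]⟩

lemma main_aux [Nontrivial V] [ProperSpace V] (Xn : ℕ → Set (ℕ → V)) (X : Set (ℕ → V))
    (hOn : ∀ n, IsOFamily (Xn n)) (hO : IsOFamily X)
    (hstn : ∀ n, LyapunovStable (Xn n))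
    (hconv : OFamTendsto Xn X) (hqc : QuasiControllable X) :
    LyapunovStable X := by
  choose p C a b h1 h2 h3 h4 h5 ha ha2 hb hb2 using fun n => core (hOn n) (hstn n)
  have hCpos : ∀ n, 0 < C n := by
    intro n
    have e1 := h1 n (a n)
    have e2 := h5 n (a n)
    rw [ha n] at e1 e2
    linarith
  by_cases hK : ∃ K, ∃ᶠ n in atTop, C n ≤ K
  · obtain ⟨K, hK⟩ := hK
    have hKpos : 0 < K := by
      obtain ⟨n, hn⟩ := hK.exists
      exact (hCpos n).trans_le hn
    refine ⟨K, hKpos, fun x t u hu => le_of_forall_pos_le_add fun ε hε => ?_⟩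
    obtain ⟨n, hn, w, hw, hd⟩ := (hK.and_eventually (approx hOn hO hconv hu hε)).exists
    have e1 : ‖w‖ ≤ K * ‖x‖ := (h1 n w).trans ((h4 n x t w hw).trans ((h5 n x).trans
      (mul_le_mul_of_nonneg_right hn (norm_nonneg x))))
    have e2 : ‖u‖ ≤ ‖u - w‖ + ‖w‖ := by simpa using norm_add_le (u - w) w
    linarith
  · exfalso
    have hCt : Tendsto C atTop atTop := by
      rw [Filter.tendsto_atTop]
      intro K
      have : ∀ᶠ n in atTop, ¬ C n ≤ K := by
        by_contra hcon
        exact hK ⟨K, by simpa [Filter.Frequently] using hcon⟩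
      filter_upwards [this] with n hn
      exact (not_le.1 hn).le
    let U : Ultrafilter ℕ := Ultrafilter.of atTop
    have hU : (U : Filter ℕ) ≤ atTop := Ultrafilter.of_le atTop
    have hlim : ∀ c : ℕ → V, (∀ n, ‖c n‖ = 1) → ∃ c0, ‖c0‖ = 1 ∧ Tendsto c U (nhds c0) := by
      intro c hc
      obtain ⟨c0, hc0, hle⟩ := (isCompact_sphere (0 : V) 1).ultrafilter_le_nhds (U.map c)
        (by
          rw [le_principal_iff]
          exact Filter.univ_mem' (f := (U : Filter ℕ)) (fun n => by simpa using hc n))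
      exact ⟨c0, by simpa using hc0, hle⟩
    have hq0 : ∀ n v, 0 ≤ p n v / C n := fun n v =>
      div_nonneg ((norm_nonneg v).trans (h1 n v)) (hCpos n).le
    have hq1 : ∀ n v, p n v / C n ≤ ‖v‖ := by
      intro n v
      rw [div_le_iff₀ (hCpos n), mul_comm]
      exact h5 n v
    have hq2 : ∀ n u v, p n (u + v) / C n ≤ p n u / C n + p n v / C n := by
      intro n u v
      rw [← add_div]
      exact div_le_div_of_nonneg_right (h2 n u v) (hCpos n).le
    have hqL : ∀ n u v, p n u / C n ≤ ‖u - v‖ + p n v / C n := by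
      intro n u v
      have e := hq2 n (u - v) v
      rw [sub_add_cancel] at e
      linarith [hq1 n (u - v)]
    let E : Submodule ℝ V :=
      { carrier := {v | Tendsto (fun n => p n v / C n) U (nhds 0)}
        zero_mem' := by
          refine squeeze_zero (fun n => hq0 n 0) (fun n => hq1 n 0) ?_
          simp
        add_mem' := by
          intro u v hu hv
          refine squeeze_zero (fun n => hq0 n _) (fun n => hq2 n u v) ?_
          simpa using hu.add hv
        smul_mem' := by
          intro c v hv
          refine squeeze_zero (g := fun n => |c| * (p n v / C n)) (fun n => hq0 n _)
            (fun n => ?_) ?_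
          · rw [← mul_div_assoc]
            exact div_le_div_of_nonneg_right (h3 n c v) (hCpos n).le
          · simpa using hv.const_mul |c| }
    have hE : ∀ v, v ∈ E ↔ Tendsto (fun n => p n v / C n) U (nhds 0) := fun v => Iff.rfl
    obtain ⟨a0, ha0, hat⟩ := hlim a ha
    obtain ⟨b0, hb0, hbt⟩ := hlim b hb
    apply hqc
    refine ⟨E, ?_, ?_, ?_⟩
    · intro hbot
      have hbE : b0 ∈ E := by
        rw [hE]
        refine squeeze_zero (g := fun n => ‖b0 - b n‖ + 2 / C n) (fun n => hq0 n _)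
          (fun n => ?_) ?_
        · have := div_le_div_of_nonneg_right (hb2 n) (hCpos n).le
          linarith [hqL n b0 (b n)]
        · have e1 : Tendsto (fun n => ‖b0 - b n‖) U (nhds 0) := by
            simpa using (tendsto_const_nhds (x := b0) |>.sub hbt).norm
          have e2 : Tendsto (fun n => 2 / C n) U (nhds 0) :=
            (hCt.mono_left hU).const_div_atTop 2
          simpa using e1.add e2
      rw [hbot, Submodule.mem_bot] at hbE
      simp [hbE] at hb0
    · intro htop
      have haE : a0 ∈ E := by rw [htop]; trivial
      rw [hE] at haE
      have e1 : Tendsto (fun n => ‖a n - a0‖) U (nhds 0) := by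
        simpa using (hat.sub (tendsto_const_nhds (x := a0))).norm
      have e2 := e1.add haE
      rw [add_zero] at e2
      have e3 : (1/2 : ℝ) ≤ 0 := by
        refine ge_of_tendsto' e2 fun n => ?_
        refine le_trans ?_ (hqL n (a n) a0)
        rw [le_div_iff₀ (hCpos n)]
        linarith [ha2 n]
      norm_num at e3
    · intro v hv t w hw
      change w ∈ E
      rw [hE] at hv ⊢
      rw [Metric.tendsto_nhds] at hv ⊢
      intro ε hε
      filter_upwards [hv (ε/2) (by linarith), hU (approx hOn hO hconv hw (half_pos hε))]
        with n hn hn2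
      obtain ⟨z, hz, hd⟩ := hn2
      rw [Real.dist_0_eq_abs, abs_of_nonneg (hq0 n _)] at hn ⊢
      have := div_le_div_of_nonneg_right (h4 n v t z hz) (hCpos n).le
      linarith [hqL n w z]

end helpers

/-- If Lyapunov stable O-families `𝒳ₙ` converge to a quasi-controllable O-family `𝒳`,
then `𝒳` is Lyapunov stable as well. -/
theorem lyapunovStable_of_tendsto {N : ℕ} (hN : 1 ≤ N)
    (Xn : ℕ → Set (ℕ → EuclideanSpace ℝ (Fin N))) (X : Set (ℕ → EuclideanSpace ℝ (Fin N)))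
    (hOn : ∀ n, IsOFamily (Xn n)) (hO : IsOFamily X)
    (hstn : ∀ n, LyapunovStable (Xn n))
    (hconv : OFamTendsto Xn X) (hqc : QuasiControllable X) :
    LyapunovStable X := by
  haveI : Nonempty (Fin N) := ⟨⟨0, hN⟩⟩
  haveI : Nontrivial (EuclideanSpace ℝ (Fin N)) := inferInstance
  exact main_aux Xn X hOn hO hstn hconv hqc
end
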